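/- Consider the featured correlated Gaussian Wigner model with π* the identity, and the relaxed objective f(Π) = λ·‖A1Π − ΠA2‖_F² + (1−λ)·Σ_{i=1}^d ‖B_1^iΠ − ΠB_2^i‖_F² over the Birkhoff polytope W^n, with projected gradient descent iterates Π^{k+1} = Proj_{W^n}(Π^k − η∇f(Π^k)) (Euclidean projection). For any realization of the two graphs G1, G2 there exists a constant L = L(G1,G2) such that for any step size η ≤ 1/L and any 0 < δ < 1: if d > 32·log(n/√δ), then with probability at least 1−δ (over the random features), ‖Π^K − Π'‖_F ≤ √( n / ((1−λ)(1−r)·d·η·K) ) for every integer K ≥ 1, where Π' ∈ argmin_{Π∈W^n} f(Π) and Π^0 ∈ W^n is the initial state. -/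

import Mathlib

open MeasureTheory ProbabilityTheory Filter
open scoped ENNReal

namespace FCGW

/-- `phi x = x / (1 - x^2)`, the weight function `φ` from the paper. -/
noncomputable def phi (x : ℝ) : ℝ := x / (1 - x ^ 2)

/-- The edge set of the complete graph on `Fin n`: non-diagonal unordered pairs. -/
abbrev Edge (n : ℕ) := {e : Sym2 (Fin n) // ¬ e.IsDiag}

lemma map_not_isDiag {n : ℕ} (π : Equiv.Perm (Fin n)) (e : Sym2 (Fin n)) :
    ¬ e.IsDiag → ¬ (Sym2.map π e).IsDiag := by
  induction e using Sym2.ind with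
  | _ x y =>
    simp only [Sym2.map_pair_eq, Sym2.mk_isDiag_iff]
    exact fun he h => he (π.injective h)

/-- Action of a vertex permutation on edges: `π({u,v}) = {π(u), π(v)}`. -/
def edgeMap {n : ℕ} (π : Equiv.Perm (Fin n)) (e : Edge n) : Edge n :=
  ⟨Sym2.map π e.1, map_not_isDiag π e.1 e.2⟩

/-- The observation space: edge weights of `G1`, edge weights of `G2`,
features of `G1`, features of `G2`. -/
abbrev Obs (n d : ℕ) :=
  (Edge n → ℝ) × (Edge n → ℝ) × (Fin n → Fin d → ℝ) × (Fin n → Fin d → ℝ)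

/-- The law of a pair of jointly Gaussian standard normals with correlation `ρ`,
i.e. a centered Gaussian vector in `ℝ²` with covariance `[[1, ρ], [ρ, 1]]`. -/
noncomputable def gaussianPair (ρ : ℝ) : Measure (ℝ × ℝ) :=
  Measure.map (fun z : ℝ × ℝ => (z.1, ρ * z.1 + Real.sqrt (1 - ρ ^ 2) * z.2))
    ((gaussianReal 0 1).prod (gaussianReal 0 1))

/-- The law `N(0, Σ_d)` with `Σ_d = [[I_d, r I_d], [r I_d, I_d]]` of a correlated
feature pair `(x, y) ∈ ℝ^d × ℝ^d`. -/
noncomputable def featurePair (d : ℕ) (r : ℝ) : Measure ((Fin d → ℝ) × (Fin d → ℝ)) :=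
  Measure.map (fun z : (Fin d → ℝ) × (Fin d → ℝ) =>
      (z.1, fun i => r * z.1 i + Real.sqrt (1 - r ^ 2) * z.2 i))
    ((Measure.pi fun _ : Fin d => gaussianReal 0 1).prod
      (Measure.pi fun _ : Fin d => gaussianReal 0 1))

/-- The underlying randomness of the featured correlated Gaussian Wigner model:
independent correlated Gaussian pairs for each edge of `G1` and independent
correlated feature pairs for each vertex of `G1`. -/
noncomputable def sample (n d : ℕ) (ρ r : ℝ) :
    Measure ((Edge n → ℝ × ℝ) × (Fin n → (Fin d → ℝ) × (Fin d → ℝ))) :=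
  (Measure.pi fun _ : Edge n => gaussianPair ρ).prod
    (Measure.pi fun _ : Fin n => featurePair d r)

/-- The observations `(β(G1), β(G2), x, y)` produced from the underlying
randomness when the latent vertex correspondence is `πs`: the pair at edge `e`
gives the weight of `e` in `G1` and of `πs(e)` in `G2`, and the feature pair at a
vertex `v` gives the feature of `v` in `G1` and of `πs(v)` in `G2`. -/
noncomputable def obsOf {n d : ℕ} (πs : Equiv.Perm (Fin n))
    (ω : (Edge n → ℝ × ℝ) × (Fin n → (Fin d → ℝ) × (Fin d → ℝ))) : Obs n d :=
  (fun e => (ω.1 e).1,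
   fun f => (ω.1 (edgeMap πs⁻¹ f)).2,
   fun v => (ω.2 v).1,
   fun v => (ω.2 (πs⁻¹ v)).2)

/-- The law of the observed pair of featured graphs `(G1, G2)` under the featured
correlated Gaussian Wigner model `G(n, d, ρ, r)` with latent correspondence `πs`. -/
noncomputable def obsLaw (n d : ℕ) (ρ r : ℝ) (πs : Equiv.Perm (Fin n)) :
    Measure (Obs n d) :=
  Measure.map (obsOf πs) (sample n d ρ r)

/-- The similarity score
`S_π = φ(ρ) Σ_e β_e(G1) β_{π(e)}(G2) + φ(r) Σ_v ⟪x_v, y_{π(v)}⟫`. -/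
noncomputable def score {n d : ℕ} (ρ r : ℝ) (o : Obs n d) (π : Equiv.Perm (Fin n)) : ℝ :=
  phi ρ * ∑ e : Edge n, o.1 e * o.2.1 (edgeMap π e)
    + phi r * ∑ v : Fin n, ∑ i : Fin d, o.2.2.1 v i * o.2.2.2 (π v) i

/-- `overlap(π, π') = |{v : π v = π' v}| / n`. -/
noncomputable def overlap {n : ℕ} (π π' : Equiv.Perm (Fin n)) : ℝ :=
  ((Finset.univ.filter fun v => π v = π' v).card : ℝ) / n

/-- The Hamming distance `d(π, π') = |{v : π v ≠ π' v}|`. -/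
def hamming {n : ℕ} (π π' : Equiv.Perm (Fin n)) : ℕ :=
  (Finset.univ.filter fun v => π v ≠ π' v).card

instance {n : ℕ} : MeasurableSpace (Equiv.Perm (Fin n)) := ⊤

/-- The Bayesian joint law of `(π*, (G1, G2))` when `π*` is uniform on `S_n`. -/
noncomputable def bayesLaw (n d : ℕ) (ρ r : ℝ) :
    Measure (Equiv.Perm (Fin n) × Obs n d) :=
  (Nat.factorial n : ℝ≥0∞)⁻¹ •
    ∑ π : Equiv.Perm (Fin n), Measure.map (fun o => (π, o)) (obsLaw n d ρ r π)

/-- Squared Frobenius norm of a matrix. -/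
noncomputable def frobSq {n : ℕ} (M : Matrix (Fin n) (Fin n) ℝ) : ℝ :=
  ∑ i, ∑ j, M i j ^ 2

/-- The Birkhoff polytope of `n × n` doubly stochastic matrices. -/
def birkhoff (n : ℕ) : Set (Matrix (Fin n) (Fin n) ℝ) :=
  {W | (∀ i j, 0 ≤ W i j) ∧ (∀ i, ∑ j, W i j = 1) ∧ (∀ j, ∑ i, W i j = 1)}

/-- `IsProjOn X P` says that `P` is the Euclidean (Frobenius) projection of `X`
onto the Birkhoff polytope. -/
def IsProjOn {n : ℕ} (X P : Matrix (Fin n) (Fin n) ℝ) : Prop :=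
  P ∈ birkhoff n ∧ ∀ Y ∈ birkhoff n, frobSq (P - X) ≤ frobSq (Y - X)

/-- The objective
`f(P) = λ ‖A1 P − P A2‖_F² + (1 − λ) Σ_i ‖B1^i P − P B2^i‖_F²`,
where `B1^i = diag (b1 i)` and `B2^i = diag (b2 i)`. -/
noncomputable def qpObjGen {n d : ℕ} (lam : ℝ) (A1 A2 : Matrix (Fin n) (Fin n) ℝ)
    (b1 b2 : Fin d → Fin n → ℝ) (P : Matrix (Fin n) (Fin n) ℝ) : ℝ :=
  lam * frobSq (A1 * P - P * A2)
    + (1 - lam) * ∑ i : Fin d,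
        frobSq (Matrix.diagonal (b1 i) * P - P * Matrix.diagonal (b2 i))

/-- The gradient of `qpObjGen` with respect to the Frobenius inner product. -/
noncomputable def qpGradGen {n d : ℕ} (lam : ℝ) (A1 A2 : Matrix (Fin n) (Fin n) ℝ)
    (b1 b2 : Fin d → Fin n → ℝ) (P : Matrix (Fin n) (Fin n) ℝ) :
    Matrix (Fin n) (Fin n) ℝ :=
  (2 * lam) • (A1.transpose * (A1 * P - P * A2) - (A1 * P - P * A2) * A2.transpose)
    + (2 * (1 - lam)) • ∑ i : Fin d,
        ((Matrix.diagonal (b1 i)).transpose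
            * (Matrix.diagonal (b1 i) * P - P * Matrix.diagonal (b2 i))
          - (Matrix.diagonal (b1 i) * P - P * Matrix.diagonal (b2 i))
            * (Matrix.diagonal (b2 i)).transpose)

/-- The symmetric edge-weight (adjacency) matrix built from edge weights
indexed by non-diagonal unordered pairs (with zero diagonal). -/
noncomputable def matOf {n : ℕ} (β : Edge n → ℝ) : Matrix (Fin n) (Fin n) ℝ :=
  Matrix.of fun i j =>
    if h : i = j then 0 else β ⟨s(i, j), by rwa [Sym2.mk_isDiag_iff]⟩

/-- The QP objective evaluated on observed graphs: `A1, A2` are the edge-weight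
matrices and `B1^i = diag(x_{1i}, …, x_{ni})`, `B2^i = diag(y_{1i}, …, y_{ni})`. -/
noncomputable def qpObj {n d : ℕ} (lam : ℝ) (o : Obs n d) :
    Matrix (Fin n) (Fin n) ℝ → ℝ :=
  qpObjGen lam (matOf o.1) (matOf o.2.1) (fun i k => o.2.2.1 k i) (fun i k => o.2.2.2 k i)

/-- The gradient of the QP objective on observed graphs. -/
noncomputable def qpGrad {n d : ℕ} (lam : ℝ) (o : Obs n d) :
    Matrix (Fin n) (Fin n) ℝ → Matrix (Fin n) (Fin n) ℝ :=
  qpGradGen lam (matOf o.1) (matOf o.2.1) (fun i k => o.2.2.1 k i) (fun i k => o.2.2.2 k i)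

/-! ### Deterministic part: quadratic expansions and projected gradient descent -/

/-- Frobenius inner product. -/
noncomputable def ip {n : ℕ} (M N : Matrix (Fin n) (Fin n) ℝ) : ℝ :=
  ∑ i, ∑ j, M i j * N i j

lemma frobSq_nonneg {n : ℕ} (M : Matrix (Fin n) (Fin n) ℝ) : 0 ≤ frobSq M :=
  Finset.sum_nonneg fun _ _ => Finset.sum_nonneg fun _ _ => sq_nonneg _

lemma ip_self {n : ℕ} (M : Matrix (Fin n) (Fin n) ℝ) : ip M M = frobSq M := by
  simp [ip, frobSq, sq]

lemma ip_comm {n : ℕ} (M N : Matrix (Fin n) (Fin n) ℝ) : ip M N = ip N M := by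
  simp [ip, mul_comm]

lemma ip_add_left {n : ℕ} (M M' N : Matrix (Fin n) (Fin n) ℝ) :
    ip (M + M') N = ip M N + ip M' N := by
  simp [ip, add_mul, Finset.sum_add_distrib]

lemma ip_sub_left {n : ℕ} (M M' N : Matrix (Fin n) (Fin n) ℝ) :
    ip (M - M') N = ip M N - ip M' N := by
  simp [ip, sub_mul, Finset.sum_sub_distrib]

lemma ip_smul_left {n : ℕ} (c : ℝ) (M N : Matrix (Fin n) (Fin n) ℝ) :
    ip (c • M) N = c * ip M N := by
  simp [ip, Finset.mul_sum, mul_assoc]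

lemma ip_add_right {n : ℕ} (M N N' : Matrix (Fin n) (Fin n) ℝ) :
    ip M (N + N') = ip M N + ip M N' := by
  simp [ip, mul_add, Finset.sum_add_distrib]

lemma ip_sub_right {n : ℕ} (M N N' : Matrix (Fin n) (Fin n) ℝ) :
    ip M (N - N') = ip M N - ip M N' := by
  simp [ip, mul_sub, Finset.sum_sub_distrib]

lemma ip_smul_right {n : ℕ} (c : ℝ) (M N : Matrix (Fin n) (Fin n) ℝ) :
    ip M (c • N) = c * ip M N := by
  rw [ip_comm, ip_smul_left, ip_comm]

lemma ip_sum_left {n d : ℕ} (F : Fin d → Matrix (Fin n) (Fin n) ℝ)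
    (N : Matrix (Fin n) (Fin n) ℝ) : ip (∑ i, F i) N = ∑ i, ip (F i) N := by
  classical
  induction (Finset.univ : Finset (Fin d)) using Finset.induction_on with
  | empty => simp [ip]
  | insert a s ha ih => rw [Finset.sum_insert ha, Finset.sum_insert ha, ip_add_left, ih]

lemma ip_trace {n : ℕ} (M N : Matrix (Fin n) (Fin n) ℝ) :
    ip M N = (M.transpose * N).trace := by
  rw [ip, Finset.sum_comm]
  simp [Matrix.trace, Matrix.mul_apply]

lemma ip_mul_left {n : ℕ} (A M D : Matrix (Fin n) (Fin n) ℝ) :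
    ip (A.transpose * M) D = ip M (A * D) := by
  rw [ip_trace, ip_trace, Matrix.transpose_mul, Matrix.transpose_transpose, Matrix.mul_assoc]

lemma ip_mul_right {n : ℕ} (A M D : Matrix (Fin n) (Fin n) ℝ) :
    ip (M * A.transpose) D = ip M (D * A) := by
  rw [ip_trace, ip_trace, Matrix.transpose_mul, Matrix.transpose_transpose, Matrix.mul_assoc,
    Matrix.trace_mul_comm, Matrix.mul_assoc]

lemma frobSq_expand {n : ℕ} (M D : Matrix (Fin n) (Fin n) ℝ) (t : ℝ) :
    frobSq (M + t • D) = frobSq M + t * (2 * ip M D) + t ^ 2 * frobSq D := by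
  simp only [← ip_self, ip_add_left, ip_add_right, ip_smul_left, ip_smul_right, ip_comm D M]
  ring

lemma term_expand {n : ℕ} (A B P D : Matrix (Fin n) (Fin n) ℝ) (t : ℝ) :
    frobSq (A * (P + t • D) - (P + t • D) * B) = frobSq (A * P - P * B)
      + t * (2 * ip (A.transpose * (A * P - P * B) - (A * P - P * B) * B.transpose) D)
      + t ^ 2 * frobSq (A * D - D * B) := by
  have : A * (P + t • D) - (P + t • D) * B = (A * P - P * B) + t • (A * D - D * B) := by
    simp only [Matrix.mul_add, Matrix.add_mul, Matrix.mul_smul, Matrix.smul_mul, smul_sub]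
    abel
  rw [this, frobSq_expand, ip_sub_left (A.transpose * _), ip_mul_left, ip_mul_right, ip_sub_right]

lemma qpObjGen_expand {n d : ℕ} (lam : ℝ) (A1 A2 : Matrix (Fin n) (Fin n) ℝ)
    (b1 b2 : Fin d → Fin n → ℝ) (P D : Matrix (Fin n) (Fin n) ℝ) (t : ℝ) :
    qpObjGen lam A1 A2 b1 b2 (P + t • D) = qpObjGen lam A1 A2 b1 b2 P
      + t * ip (qpGradGen lam A1 A2 b1 b2 P) D + t ^ 2 * qpObjGen lam A1 A2 b1 b2 D := by
  simp only [qpObjGen, qpGradGen, term_expand, ip_add_left, ip_smul_left, ip_sum_left,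
    Finset.sum_add_distrib, ← Finset.mul_sum]
  ring

lemma frobSq_diag {n : ℕ} (a b : Fin n → ℝ) (P : Matrix (Fin n) (Fin n) ℝ) :
    frobSq (Matrix.diagonal a * P - P * Matrix.diagonal b)
      = ∑ j, ∑ k, (a j - b k) ^ 2 * P j k ^ 2 := by
  simp only [frobSq, Matrix.sub_apply, Matrix.diagonal_mul, Matrix.mul_diagonal]
  refine Finset.sum_congr rfl fun j _ => Finset.sum_congr rfl fun k _ => ?_
  ring

lemma qpObjGen_nonneg {n d : ℕ} {lam : ℝ} (h0 : 0 ≤ lam) (h1 : lam ≤ 1)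
    (A1 A2 : Matrix (Fin n) (Fin n) ℝ)
    (b1 b2 : Fin d → Fin n → ℝ) (P : Matrix (Fin n) (Fin n) ℝ) :
    0 ≤ qpObjGen lam A1 A2 b1 b2 P :=
  add_nonneg (mul_nonneg h0 (frobSq_nonneg _))
    (mul_nonneg (sub_nonneg.2 h1) (Finset.sum_nonneg fun _ _ => frobSq_nonneg _))

lemma frobSq_mul_le {n : ℕ} (A B : Matrix (Fin n) (Fin n) ℝ) :
    frobSq (A * B) ≤ frobSq A * frobSq B := by
  have h : ∀ i j, (A * B) i j ^ 2 ≤ (∑ k, A i k ^ 2) * (∑ k, B k j ^ 2) := fun i j => by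
    rw [Matrix.mul_apply]
    exact Finset.sum_mul_sq_le_sq_mul_sq _ _ _
  calc frobSq (A * B) ≤ ∑ i, ∑ j, (∑ k, A i k ^ 2) * (∑ k, B k j ^ 2) :=
        Finset.sum_le_sum fun i _ => Finset.sum_le_sum fun j _ => h i j
    _ = frobSq A * frobSq B := by
        rw [← Finset.sum_mul_sum]
        congr 1
        exact Finset.sum_comm

lemma frobSq_sub_le {n : ℕ} (A B : Matrix (Fin n) (Fin n) ℝ) :
    frobSq (A - B) ≤ 2 * frobSq A + 2 * frobSq B := by
  simp only [frobSq, Finset.mul_sum, ← Finset.sum_add_distrib]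
  refine Finset.sum_le_sum fun i _ => Finset.sum_le_sum fun j _ => ?_
  rw [Matrix.sub_apply]
  nlinarith [sq_nonneg (A i j + B i j)]

/-- An explicit smoothness constant of the objective. -/
noncomputable def smoothGen {n d : ℕ} (lam : ℝ) (A1 A2 : Matrix (Fin n) (Fin n) ℝ)
    (b1 b2 : Fin d → Fin n → ℝ) : ℝ :=
  1 + 2 * (lam * (2 * frobSq A1 + 2 * frobSq A2)
    + (1 - lam) * ∑ i, ∑ j, ∑ k, (b1 i j - b2 i k) ^ 2)

lemma smoothGen_pos {n d : ℕ} {lam : ℝ} (h0 : 0 ≤ lam) (h1 : lam ≤ 1)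
    (A1 A2 : Matrix (Fin n) (Fin n) ℝ) (b1 b2 : Fin d → Fin n → ℝ) :
    0 < smoothGen lam A1 A2 b1 b2 := by
  have h2 := mul_nonneg h0 (add_nonneg (mul_nonneg zero_le_two (frobSq_nonneg A1))
    (mul_nonneg zero_le_two (frobSq_nonneg A2)))
  have h3 : 0 ≤ (1 - lam) * ∑ i, ∑ j, ∑ k, (b1 i j - b2 i k) ^ 2 :=
    mul_nonneg (sub_nonneg.2 h1) (Finset.sum_nonneg fun _ _ => Finset.sum_nonneg fun _ _ =>
      Finset.sum_nonneg fun _ _ => sq_nonneg _)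
  unfold smoothGen
  linarith

lemma smoothGen_spec {n d : ℕ} {lam : ℝ} (h0 : 0 ≤ lam) (h1 : lam ≤ 1)
    (A1 A2 : Matrix (Fin n) (Fin n) ℝ) (b1 b2 : Fin d → Fin n → ℝ)
    (D : Matrix (Fin n) (Fin n) ℝ) :
    qpObjGen lam A1 A2 b1 b2 D ≤ smoothGen lam A1 A2 b1 b2 / 2 * frobSq D := by
  have hD := frobSq_nonneg D
  have e1 : frobSq (A1 * D - D * A2) ≤ (2 * frobSq A1 + 2 * frobSq A2) * frobSq D := by
    have := frobSq_sub_le (A1 * D) (D * A2)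
    have := frobSq_mul_le A1 D
    have := frobSq_mul_le D A2
    nlinarith
  have e2 : ∑ i, frobSq (Matrix.diagonal (b1 i) * D - D * Matrix.diagonal (b2 i))
      ≤ (∑ i, ∑ j, ∑ k, (b1 i j - b2 i k) ^ 2) * frobSq D := by
    rw [Finset.sum_mul]
    refine Finset.sum_le_sum fun i _ => ?_
    rw [frobSq_diag, Finset.sum_mul]
    refine Finset.sum_le_sum fun j _ => ?_
    rw [Finset.sum_mul]
    refine Finset.sum_le_sum fun k _ => mul_le_mul_of_nonneg_left ?_ (sq_nonneg _)
    calc D j k ^ 2 ≤ ∑ k, D j k ^ 2 :=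
          Finset.single_le_sum (f := fun k => D j k ^ 2) (fun _ _ => sq_nonneg _)
            (Finset.mem_univ k)
      _ ≤ frobSq D := Finset.single_le_sum (f := fun j => ∑ k, D j k ^ 2)
            (fun _ _ => Finset.sum_nonneg fun _ _ => sq_nonneg _) (Finset.mem_univ j)
  have := mul_le_mul_of_nonneg_left e1 h0
  have := mul_le_mul_of_nonneg_left e2 (sub_nonneg.2 h1)
  unfold qpObjGen smoothGen
  nlinarith

lemma strong_spec {n d : ℕ} {lam : ℝ} (h0 : 0 ≤ lam) (h1 : lam ≤ 1)
    (A1 A2 : Matrix (Fin n) (Fin n) ℝ) (b1 b2 : Fin d → Fin n → ℝ) (m : ℝ)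
    (hm : ∀ j k, m ≤ ∑ i, (b1 i j - b2 i k) ^ 2)
    (D : Matrix (Fin n) (Fin n) ℝ) :
    (1 - lam) * m * frobSq D ≤ qpObjGen lam A1 A2 b1 b2 D := by
  have e2 : m * frobSq D
      ≤ ∑ i, frobSq (Matrix.diagonal (b1 i) * D - D * Matrix.diagonal (b2 i)) := by
    simp only [frobSq_diag]
    rw [Finset.sum_comm, frobSq, Finset.mul_sum]
    refine Finset.sum_le_sum fun j _ => ?_
    rw [Finset.sum_comm, Finset.mul_sum]
    refine Finset.sum_le_sum fun k _ => ?_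
    rw [← Finset.sum_mul]
    exact mul_le_mul_of_nonneg_right (hm j k) (sq_nonneg _)
  have := mul_le_mul_of_nonneg_left e2 (sub_nonneg.2 h1)
  have := mul_nonneg h0 (frobSq_nonneg (A1 * D - D * A2))
  unfold qpObjGen
  linarith

lemma birkhoff_segment {n : ℕ} {P Y : Matrix (Fin n) (Fin n) ℝ} (hP : P ∈ birkhoff n)
    (hY : Y ∈ birkhoff n) {t : ℝ} (h0 : 0 ≤ t) (h1 : t ≤ 1) :
    P + t • (Y - P) ∈ birkhoff n := by
  obtain ⟨p1, p2, p3⟩ := hP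
  obtain ⟨y1, y2, y3⟩ := hY
  refine ⟨fun i j => ?_, fun i => ?_, fun j => ?_⟩
  · simp only [Matrix.add_apply, Matrix.smul_apply, Matrix.sub_apply, smul_eq_mul]
    nlinarith [mul_nonneg h0 (y1 i j), mul_nonneg (sub_nonneg.2 h1) (p1 i j)]
  · simp [Finset.sum_add_distrib, ← Finset.mul_sum, p2, y2]
  · simp [Finset.sum_add_distrib, ← Finset.mul_sum, p3, y3]

/-- First-order condition from nonnegativity of a quadratic on `[0,1]`. -/
lemma first_order {a b : ℝ} (h : ∀ t : ℝ, 0 ≤ t → t ≤ 1 → 0 ≤ t * a + t ^ 2 * b) : 0 ≤ a := by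
  by_contra ha
  push Not at ha
  have hb : 0 < |b| + |a| :=
    add_pos_of_nonneg_of_pos (abs_nonneg _) (abs_pos.2 ha.ne)
  have hle : -a / (2 * (|b| + |a|)) ≤ 1 := by
    rw [div_le_one (by positivity)]
    nlinarith [abs_nonneg b, neg_abs_le a]
  have hpos : 0 < -a / (2 * (|b| + |a|)) := div_pos (by linarith) (by positivity)
  have := h _ hpos.le hle
  set t := -a / (2 * (|b| + |a|)) with ht
  have e : t * (2 * (|b| + |a|)) = -a := by rw [ht]; field_simp
  have : 0 ≤ a + t * b := by
    by_contra hc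
    push Not at hc
    nlinarith
  nlinarith [le_abs_self b, abs_nonneg a, mul_le_mul_of_nonneg_left (le_abs_self b) hpos.le,
    mul_nonneg hpos.le (abs_nonneg a)]

lemma proj_ineq {n : ℕ} {X Q Z : Matrix (Fin n) (Fin n) ℝ} (h : IsProjOn X Q)
    (hZ : Z ∈ birkhoff n) : 0 ≤ ip (Q - X) (Z - Q) := by
  have : 0 ≤ 2 * ip (Q - X) (Z - Q) := by
    refine first_order (b := frobSq (Z - Q)) fun t h0 h1 => ?_
    have := h.2 _ (birkhoff_segment h.1 hZ h0 h1)
    have e : Q + t • (Z - Q) - X = (Q - X) + t • (Z - Q) := by abel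
    rw [e, frobSq_expand] at this
    linarith
  linarith

lemma birkhoff_dist {n : ℕ} {P Y : Matrix (Fin n) (Fin n) ℝ} (hP : P ∈ birkhoff n)
    (hY : Y ∈ birkhoff n) : frobSq (P - Y) ≤ 2 * n := by
  have key : ∀ i j, (P i j - Y i j) ^ 2 ≤ P i j + Y i j := fun i j => by
    have hp0 := hP.1 i j
    have hy0 := hY.1 i j
    have hp1 : P i j ≤ 1 := (hP.2.1 i) ▸
      Finset.single_le_sum (f := fun j => P i j) (fun j _ => hP.1 i j) (Finset.mem_univ j)
    have hy1 : Y i j ≤ 1 := (hY.2.1 i) ▸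
      Finset.single_le_sum (f := fun j => Y i j) (fun j _ => hY.1 i j) (Finset.mem_univ j)
    nlinarith [mul_nonneg hp0 hy0]
  calc frobSq (P - Y) ≤ ∑ i, ∑ j, (P i j + Y i j) :=
        Finset.sum_le_sum fun i _ => Finset.sum_le_sum fun j _ => key i j
    _ = 2 * n := by
        simp [Finset.sum_add_distrib, hP.2.1, hY.2.1]
        ring

/-- Deterministic convergence rate of projected gradient descent for the quadratic objective. -/
lemma pgd_rate {n d : ℕ} {lam : ℝ} (h0 : 0 ≤ lam) (h1 : lam ≤ 1)
    (A1 A2 : Matrix (Fin n) (Fin n) ℝ) (b1 b2 : Fin d → Fin n → ℝ) (m : ℝ)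
    (hm : ∀ j k, m ≤ ∑ i, (b1 i j - b2 i k) ^ 2) (η : ℝ) (hη : 0 < η)
    (hηL : η ≤ (smoothGen lam A1 A2 b1 b2)⁻¹)
    (P : ℕ → Matrix (Fin n) (Fin n) ℝ) (hP0 : P 0 ∈ birkhoff n)
    (hP : ∀ k, IsProjOn (P k - η • qpGradGen lam A1 A2 b1 b2 (P k)) (P (k + 1)))
    (Z : Matrix (Fin n) (Fin n) ℝ) (hZ : Z ∈ birkhoff n)
    (hopt : ∀ Y ∈ birkhoff n, qpObjGen lam A1 A2 b1 b2 Z ≤ qpObjGen lam A1 A2 b1 b2 Y)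
    (K : ℕ) :
    (1 - lam) * m * frobSq (P K - Z) * (η * K) ≤ n := by
  set f := qpObjGen lam A1 A2 b1 b2 with hf
  set g := qpGradGen lam A1 A2 b1 b2 with hg
  have hexp : ∀ (X D : Matrix (Fin n) (Fin n) ℝ) (t : ℝ),
      f (X + t • D) = f X + t * ip (g X) D + t ^ 2 * f D :=
    fun X D t => qpObjGen_expand lam A1 A2 b1 b2 X D t
  have hexp1 : ∀ X Y : Matrix (Fin n) (Fin n) ℝ,
      f Y = f X + ip (g X) (Y - X) + f (Y - X) := fun X Y => by
    have := hexp X (Y - X) 1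
    simpa using this
  have hmem : ∀ k, P k ∈ birkhoff n := fun k => by
    cases k with
    | zero => exact hP0
    | succ k => exact (hP k).1
  have hsm : ∀ D, 2 * η * f D ≤ frobSq D := fun D => by
    have hLpos := smoothGen_pos h0 h1 A1 A2 b1 b2
    have h3 := smoothGen_spec h0 h1 A1 A2 b1 b2 D
    have h4 : η * smoothGen lam A1 A2 b1 b2 ≤ 1 := by
      calc _ ≤ (smoothGen lam A1 A2 b1 b2)⁻¹ * smoothGen lam A1 A2 b1 b2 :=
            mul_le_mul_of_nonneg_right hηL hLpos.le
        _ = 1 := inv_mul_cancel₀ hLpos.ne'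
    have h5 := mul_le_mul_of_nonneg_left h3 hη.le
    have h6 := mul_le_mul_of_nonneg_right h4 (frobSq_nonneg D)
    rw [← hf] at h5
    nlinarith
  -- one-step inequality
  have hstep : ∀ k, ∀ Y ∈ birkhoff n,
      2 * η * (f (P (k + 1)) - f Y) ≤ frobSq (P k - Y) - frobSq (P (k + 1) - Y) := by
    intro k Y hY
    have a1 := proj_ineq (hP k) hY
    have a2 := hexp1 (P k) (P (k + 1))
    have a3 := hexp1 (P k) Y
    have a4 := hsm (P (k + 1) - P k)
    have a5 : 0 ≤ f (Y - P k) := qpObjGen_nonneg h0 h1 A1 A2 b1 b2 _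
    simp only [← ip_self, ip_sub_left, ip_sub_right, ip_smul_left] at a1 a2 a3 a4 ⊢
    rw [a2, a3]
    have c1 := ip_comm (P (k + 1)) (P k)
    have c2 := ip_comm (P (k + 1)) Y
    have c3 := ip_comm (P k) Y
    have a6 := mul_nonneg hη.le a5
    nlinarith
  have hmono : ∀ k, f (P (k + 1)) ≤ f (P k) := fun k => by
    have := hstep k (P k) (hmem k)
    have e : frobSq (P k - P k) = 0 := by simp [frobSq]
    have h3 := frobSq_nonneg (P (k + 1) - P k)
    rw [e] at this
    by_contra hc
    push Not at hc
    have := mul_pos hη (sub_pos.2 hc)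
    linarith
  have hsum : ∀ k : ℕ, 2 * η * k * (f (P k) - f Z) + frobSq (P k - Z) ≤ frobSq (P 0 - Z) := by
    intro k
    induction k with
    | zero => simp
    | succ k ih =>
      have h3 := hstep k Z hZ
      have h4 : 0 ≤ η * k * (f (P k) - f (P (k + 1))) :=
        mul_nonneg (by positivity) (sub_nonneg.2 (hmono k))
      push_cast
      linarith
  have hfo : 0 ≤ ip (g Z) (P K - Z) := by
    refine first_order (b := f (P K - Z)) fun t t0 t1 => ?_
    have h3 := hopt _ (birkhoff_segment hZ (hmem K) t0 t1)
    rw [hexp] at h3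
    linarith
  have hst : (1 - lam) * m * frobSq (P K - Z) ≤ f (P K) - f Z := by
    have h3 := strong_spec h0 h1 A1 A2 b1 b2 m hm (P K - Z)
    have h4 := hexp1 Z (P K)
    rw [← hf] at h3
    linarith
  have h3 := mul_le_mul_of_nonneg_right hst (by positivity : 0 ≤ η * K)
  have h4 := hsum K
  have h5 := birkhoff_dist hP0 hZ
  have h6 := frobSq_nonneg (P K - Z)
  linarith

/-! ### Probabilistic part: lower tails of feature distances -/

lemma gauss_lin (v1 v2 w : NNReal) (a b : ℝ) (hw : (w : ℝ) = a ^ 2 * v1 + b ^ 2 * v2) :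
    Measure.map (fun z : ℝ × ℝ => a * z.1 + b * z.2)
      ((gaussianReal 0 v1).prod (gaussianReal 0 v2)) = gaussianReal 0 w := by
  have hi : IndepFun (fun z : ℝ × ℝ => a * z.1) (fun z : ℝ × ℝ => b * z.2)
      ((gaussianReal 0 v1).prod (gaussianReal 0 v2)) :=
    indepFun_prod (X := fun x : ℝ => a * x) (Y := fun x : ℝ => b * x) (by fun_prop) (by fun_prop)
  have hX : Measure.map (fun z : ℝ × ℝ => a * z.1) ((gaussianReal 0 v1).prod (gaussianReal 0 v2))
      = gaussianReal (a * 0) (.mk (a ^ 2) (sq_nonneg _) * v1) := by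
    rw [← gaussianReal_map_const_mul,
      show (fun z : ℝ × ℝ => a * z.1) = (fun x => a * x) ∘ Prod.fst from rfl,
      ← Measure.map_map (by fun_prop) measurable_fst, Measure.map_fst_prod]
    simp
  have hY : Measure.map (fun z : ℝ × ℝ => b * z.2) ((gaussianReal 0 v1).prod (gaussianReal 0 v2))
      = gaussianReal (b * 0) (.mk (b ^ 2) (sq_nonneg _) * v2) := by
    rw [← gaussianReal_map_const_mul,
      show (fun z : ℝ × ℝ => b * z.2) = (fun x => b * x) ∘ Prod.snd from rfl,
      ← Measure.map_map (by fun_prop) measurable_snd, Measure.map_snd_prod]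
    simp
  have h := gaussianReal_add_gaussianReal_of_indepFun hi hX hY
  have e : (fun z : ℝ × ℝ => a * z.1 + b * z.2)
      = (fun z : ℝ × ℝ => a * z.1) + (fun z : ℝ × ℝ => b * z.2) := rfl
  rw [e, h]
  congr 1
  · simp
  · apply NNReal.eq
    rw [hw]
    rfl

lemma gauss_lin_pi (d : ℕ) (v1 v2 w : NNReal) (a b : ℝ) (hw : (w : ℝ) = a ^ 2 * v1 + b ^ 2 * v2) :
    Measure.map (fun z : (Fin d → ℝ) × (Fin d → ℝ) => fun i => a * z.1 i + b * z.2 i)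
      ((Measure.pi fun _ : Fin d => gaussianReal 0 v1).prod
        (Measure.pi fun _ : Fin d => gaussianReal 0 v2))
      = Measure.pi fun _ : Fin d => gaussianReal 0 w := by
  have h := (measurePreserving_arrowProdEquivProdArrow ℝ ℝ (Fin d)
    (fun _ => gaussianReal 0 v1) (fun _ => gaussianReal 0 v2)).map_eq
  rw [← h, Measure.map_map (by fun_prop) (MeasurableEquiv.measurable _)]
  have h2 := Measure.pi_map_pi (μ := fun _ : Fin d => (gaussianReal 0 v1).prod (gaussianReal 0 v2))
    (f := fun _ (z : ℝ × ℝ) => a * z.1 + b * z.2)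
    (hμ := fun i => by rw [gauss_lin v1 v2 w a b hw]; infer_instance)
    (fun i => by fun_prop)
  simp only [gauss_lin v1 v2 w a b hw] at h2
  exact h2

instance (d : ℕ) (r : ℝ) : IsProbabilityMeasure (featurePair d r) :=
  Measure.isProbabilityMeasure_map (by fun_prop)

instance (ρ : ℝ) : IsProbabilityMeasure (gaussianPair ρ) :=
  Measure.isProbabilityMeasure_map (by fun_prop)

instance (n d : ℕ) (ρ r : ℝ) : IsProbabilityMeasure (sample n d ρ r) := by
  unfold sample; infer_instance

lemma feature_fst (d : ℕ) (r : ℝ) :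
    Measure.map Prod.fst (featurePair d r) = Measure.pi fun _ : Fin d => gaussianReal 0 1 := by
  rw [featurePair, Measure.map_map measurable_fst (by fun_prop)]
  have := gauss_lin_pi d 1 1 1 1 0 (by simp)
  simpa [Function.comp_def] using this

lemma feature_snd (d : ℕ) (r : ℝ) (hr : 0 < r ∧ r < 1) :
    Measure.map Prod.snd (featurePair d r) = Measure.pi fun _ : Fin d => gaussianReal 0 1 := by
  rw [featurePair, Measure.map_map measurable_snd (by fun_prop)]
  have h : 0 ≤ 1 - r ^ 2 := by nlinarith [hr.1, hr.2]
  exact gauss_lin_pi d 1 1 1 r (Real.sqrt (1 - r ^ 2)) (by rw [Real.sq_sqrt h]; simp)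

lemma feature_diff (d : ℕ) (r : ℝ) (hr : 0 < r ∧ r < 1) (w : NNReal)
    (hw : (w : ℝ) = 2 * (1 - r)) :
    Measure.map (fun z : (Fin d → ℝ) × (Fin d → ℝ) => fun i => z.1 i - z.2 i) (featurePair d r)
      = Measure.pi fun _ : Fin d => gaussianReal 0 w := by
  rw [featurePair, Measure.map_map (by fun_prop) (by fun_prop)]
  have h : 0 ≤ 1 - r ^ 2 := by nlinarith [hr.1, hr.2]
  rw [← gauss_lin_pi d 1 1 w (1 - r) (-Real.sqrt (1 - r ^ 2))
    (by rw [neg_sq, Real.sq_sqrt h, hw]; simp; ring)]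
  congr 1
  funext z i
  simp only [Function.comp_apply]
  ring

/-- Law of `x_j - y_k`. -/
lemma diff_law (n d : ℕ) (ρ r : ℝ) (hr : 0 < r ∧ r < 1) (j k : Fin n) :
    ∃ w : NNReal, 0 < w ∧ 2 * (1 - r) ≤ (w : ℝ) ∧
      Measure.map (fun ω : (Edge n → ℝ × ℝ) × (Fin n → (Fin d → ℝ) × (Fin d → ℝ)) =>
        fun i => (ω.2 j).1 i - (ω.2 k).2 i) (sample n d ρ r)
      = Measure.pi fun _ : Fin d => gaussianReal 0 w := by
  have hs : Measure.map Prod.snd (sample n d ρ r) = Measure.pi fun _ : Fin n => featurePair d r := by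
    rw [sample, Measure.map_snd_prod]; simp
  by_cases hjk : j = k
  · subst hjk
    have hpos : 0 < 2 * (1 - r) := by linarith [hr.2]
    refine ⟨⟨2 * (1 - r), hpos.le⟩, hpos, le_rfl, ?_⟩
    rw [← feature_diff d r hr ⟨2 * (1 - r), hpos.le⟩ rfl,
      ← (measurePreserving_eval (fun _ : Fin n => featurePair d r) j).map_eq, ← hs,
      Measure.map_map (by fun_prop) (by fun_prop), Measure.map_map (by fun_prop) (by fun_prop)]
    rfl
  · refine ⟨2, by norm_num, by simp; linarith [hr.1], ?_⟩
    have hi := (iIndepFun_pi (μ := fun _ : Fin n => featurePair d r)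
      (X := fun _ z => z) (fun _ => by fun_prop)).indepFun hjk
    have hi2 := hi.comp (φ := Prod.fst) (ψ := Prod.snd) measurable_fst measurable_snd
    have h3 := hi2.map_prod_eq_prod_map_map
      (measurable_fst.comp (measurable_pi_apply j)).aemeasurable
      (measurable_snd.comp (measurable_pi_apply k)).aemeasurable
    have e1 : Measure.map (Prod.fst ∘ fun ω : Fin n → (Fin d → ℝ) × (Fin d → ℝ) => ω j)
        (Measure.pi fun _ : Fin n => featurePair d r)
        = Measure.pi fun _ : Fin d => gaussianReal 0 1 := by
      rw [← Measure.map_map measurable_fst (by fun_prop), ← feature_fst d r]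
      congr 1
      exact (measurePreserving_eval (fun _ : Fin n => featurePair d r) j).map_eq
    have e2 : Measure.map (Prod.snd ∘ fun ω : Fin n → (Fin d → ℝ) × (Fin d → ℝ) => ω k)
        (Measure.pi fun _ : Fin n => featurePair d r)
        = Measure.pi fun _ : Fin d => gaussianReal 0 1 := by
      rw [← Measure.map_map measurable_snd (by fun_prop), ← feature_snd d r hr]
      congr 1
      exact (measurePreserving_eval (fun _ : Fin n => featurePair d r) k).map_eq
    rw [e1, e2] at h3
    rw [← gauss_lin_pi d 1 1 2 1 (-1) (by norm_num), ← h3, ← hs,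
      Measure.map_map (by fun_prop) (by fun_prop), Measure.map_map (by fun_prop) (by fun_prop)]
    congr 1
    funext z i
    simp only [Function.comp_apply]
    ring

lemma gauss_sq_mgf (w : NNReal) (hw : 0 < w) :
    ∫ x, Real.exp (-(1 / (2 * w)) * x ^ 2) ∂(gaussianReal 0 w) = Real.sqrt (1 / 2) := by
  have hw' : (0 : ℝ) < w := hw
  rw [integral_gaussianReal_eq_integral_smul hw.ne']
  have e : ∀ x : ℝ, gaussianPDFReal 0 w x • Real.exp (-(1 / (2 * w)) * x ^ 2)
      = (Real.sqrt (2 * Real.pi * w))⁻¹ * Real.exp (-(1 / (w : ℝ)) * x ^ 2) := fun x => by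
    rw [gaussianPDFReal, smul_eq_mul, mul_assoc, ← Real.exp_add]
    congr 2
    field_simp
    ring
  simp_rw [e]
  rw [integral_const_mul, integral_gaussian, ← Real.sqrt_inv, ← Real.sqrt_mul (by positivity)]
  congr 1
  have := Real.pi_pos
  field_simp

lemma chi_tail (d : ℕ) (w : NNReal) (hw : 0 < w) :
    (Measure.pi fun _ : Fin d => gaussianReal 0 w).real
      {z | ∑ i, z i ^ 2 ≤ (w : ℝ) * d / 2} ≤ Real.exp (-(d : ℝ) / 16) := by
  have hw' : (0 : ℝ) < w := hw
  have e : ∀ z : Fin d → ℝ, Real.exp (-(1 / (2 * w)) * ∑ i, z i ^ 2)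
      = ∏ i, Real.exp (-(1 / (2 * w)) * z i ^ 2) := fun z => by
    rw [Finset.mul_sum, Real.exp_sum]
  have hint1 : Integrable (fun x : ℝ => Real.exp (-(1 / (2 * w)) * x ^ 2)) (gaussianReal 0 w) := by
    by_contra hc
    have h1 := gauss_sq_mgf w hw
    rw [integral_undef hc] at h1
    have h2 : 0 < Real.sqrt (1 / 2) := by positivity
    linarith
  have hint : Integrable (fun z : Fin d → ℝ => Real.exp (-(1 / (2 * w)) * ∑ i, z i ^ 2))
      (Measure.pi fun _ : Fin d => gaussianReal 0 w) := by
    simp_rw [e]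
    exact Integrable.fintype_prod (f := fun _ (x : ℝ) => Real.exp (-(1 / (2 * w)) * x ^ 2))
      fun _ => hint1
  have h := measure_le_le_exp_mul_mgf (μ := Measure.pi fun _ : Fin d => gaussianReal 0 w)
    (X := fun z : Fin d → ℝ => ∑ i, z i ^ 2) (t := -(1 / (2 * w))) ((w : ℝ) * d / 2)
    (by rw [neg_nonpos]; positivity) hint
  refine h.trans ?_
  rw [mgf]
  simp_rw [e]
  rw [integral_fintype_prod_eq_prod (fun _ (x : ℝ) => Real.exp (-(1 / (2 * w)) * x ^ 2))]
  simp_rw [gauss_sq_mgf w hw]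
  rw [Finset.prod_const, Finset.card_univ, Fintype.card_fin]
  have e3 : Real.sqrt (1 / 2) = Real.exp (-(Real.log 2 / 2)) := by
    rw [Real.sqrt_eq_rpow, Real.rpow_def_of_pos (by norm_num), one_div, Real.log_inv]
    congr 1
    ring
  rw [e3, ← Real.exp_nat_mul, ← Real.exp_add, Real.exp_le_exp]
  have e4 : - -(1 / (2 * (w : ℝ))) * (w * d / 2) = d / 4 := by
    field_simp
    ring
  rw [e4]
  have hl := Real.log_two_gt_d9
  have hd : (0 : ℝ) ≤ d := Nat.cast_nonneg d
  nlinarith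

lemma diff_tail (n d : ℕ) (ρ r : ℝ) (hr : 0 < r ∧ r < 1) (j k : Fin n) :
    sample n d ρ r {ω | ∑ i, ((ω.2 j).1 i - (ω.2 k).2 i) ^ 2 < (1 - r) * d}
      ≤ ENNReal.ofReal (Real.exp (-(d : ℝ) / 16)) := by
  obtain ⟨w, hw, hwr, hlaw⟩ := diff_law n d ρ r hr j k
  have hd : (0 : ℝ) ≤ d := Nat.cast_nonneg d
  have h := chi_tail d w hw
  have hmeas : MeasurableSet {z : Fin d → ℝ | ∑ i, z i ^ 2 ≤ (w : ℝ) * d / 2} :=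
    measurableSet_le (by fun_prop) (by fun_prop)
  have h2 : (Measure.pi fun _ : Fin d => gaussianReal 0 w) {z | ∑ i, z i ^ 2 ≤ (w : ℝ) * d / 2}
      ≤ ENNReal.ofReal (Real.exp (-(d : ℝ) / 16)) := by
    rw [← ofReal_measureReal]
    exact ENNReal.ofReal_le_ofReal h
  rw [← hlaw, Measure.map_apply (by fun_prop) hmeas] at h2
  refine (measure_mono fun ω hω => ?_).trans h2
  simp only [Set.mem_setOf_eq, Set.mem_preimage] at hω ⊢
  nlinarith [mul_le_mul_of_nonneg_right hwr hd]

lemma measurable_obsOf {n d : ℕ} (πs : Equiv.Perm (Fin n)) :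
    Measurable (obsOf (d := d) πs) := by
  unfold obsOf
  fun_prop

/-- With probability at least `1 - δ`, all feature distances are at least `(1 - r) d`. -/
lemma good_event (n d : ℕ) (ρ r : ℝ) (hr : 0 < r ∧ r < 1) (δ : ℝ) (hδ : 0 < δ)
    (hd : 32 * Real.log ((n : ℝ) / Real.sqrt δ) < (d : ℝ)) :
    1 - ENNReal.ofReal δ ≤ obsLaw n d ρ r 1
      {o | ∀ j k, (1 - r) * d ≤ ∑ i, (o.2.2.1 j i - o.2.2.2 k i) ^ 2} := by
  have hmeas : MeasurableSet {o : Obs n d |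
      ∀ j k, (1 - r) * d ≤ ∑ i, (o.2.2.1 j i - o.2.2.2 k i) ^ 2} := by
    simp only [Set.setOf_forall]
    exact MeasurableSet.iInter fun j => MeasurableSet.iInter fun k =>
      measurableSet_le (by fun_prop) (by fun_prop)
  haveI : IsProbabilityMeasure (obsLaw n d ρ r 1) :=
    Measure.isProbabilityMeasure_map (measurable_obsOf 1).aemeasurable
  have hnum : (n : ℝ) * (n * Real.exp (-(d : ℝ) / 16)) ≤ δ := by
    rcases Nat.eq_zero_or_pos n with h0 | h0
    · simp [h0, hδ.le]
    · have hn : (0 : ℝ) < n := by exact_mod_cast h0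
      have hs : 0 < Real.sqrt δ := Real.sqrt_pos.2 hδ
      have h1 : (n : ℝ) / Real.sqrt δ < Real.exp (d / 32) := by
        rw [← Real.log_lt_iff_lt_exp (by positivity)]
        linarith
      have h2 : (n : ℝ) < Real.exp (d / 32) * Real.sqrt δ := by rwa [div_lt_iff₀ hs] at h1
      have h3 : (n : ℝ) * Real.exp (-(d / 32)) ≤ Real.sqrt δ := by
        rw [Real.exp_neg, ← div_eq_mul_inv, div_le_iff₀ (Real.exp_pos _)]
        linarith
      have h4 : Real.exp (-(d : ℝ) / 16) = Real.exp (-(d / 32)) * Real.exp (-(d / 32)) := by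
        rw [← Real.exp_add]
        congr 1
        ring
      rw [h4]
      calc _ = ((n : ℝ) * Real.exp (-(d / 32))) * ((n : ℝ) * Real.exp (-(d / 32))) := by ring
        _ ≤ Real.sqrt δ * Real.sqrt δ := mul_self_le_mul_self (by positivity) h3
        _ = δ := Real.mul_self_sqrt hδ.le
  have hbad : obsLaw n d ρ r 1 {o : Obs n d |
      ∀ j k, (1 - r) * d ≤ ∑ i, (o.2.2.1 j i - o.2.2.2 k i) ^ 2}ᶜ ≤ ENNReal.ofReal δ := by
    rw [obsLaw, Measure.map_apply (measurable_obsOf 1) hmeas.compl]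
    calc _ ≤ sample n d ρ r (⋃ j : Fin n, ⋃ k : Fin n,
            {ω | ∑ i, ((ω.2 j).1 i - (ω.2 k).2 i) ^ 2 < (1 - r) * d}) := by
          refine measure_mono fun ω hω => ?_
          simp only [Set.mem_preimage, Set.mem_compl_iff, Set.mem_setOf_eq, not_forall,
            not_le] at hω
          simp only [Set.mem_iUnion, Set.mem_setOf_eq]
          exact hω
      _ ≤ ∑ j : Fin n, ∑ k : Fin n, sample n d ρ r
            {ω | ∑ i, ((ω.2 j).1 i - (ω.2 k).2 i) ^ 2 < (1 - r) * d} :=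
          (measure_iUnion_fintype_le _ _).trans
            (Finset.sum_le_sum fun j _ => measure_iUnion_fintype_le _ _)
      _ ≤ ∑ _j : Fin n, ∑ _k : Fin n, ENNReal.ofReal (Real.exp (-(d : ℝ) / 16)) :=
          Finset.sum_le_sum fun j _ => Finset.sum_le_sum fun k _ => diff_tail n d ρ r hr j k
      _ = ENNReal.ofReal ((n : ℝ) * (n * Real.exp (-(d : ℝ) / 16))) := by
          rw [ENNReal.ofReal_mul (by positivity), ENNReal.ofReal_mul (by positivity)]
          simp
      _ ≤ ENNReal.ofReal δ := ENNReal.ofReal_le_ofReal hnum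
  have h1 := prob_add_prob_compl (μ := obsLaw n d ρ r 1) hmeas
  rw [tsub_le_iff_right, ← h1]
  gcongr

/-- The smoothness constant `L(G1, G2)` of the objective. It is strictly positive. -/
noncomputable def smoothL {n d : ℕ} (lam : ℝ) (o : Obs n d) : ℝ :=
  smoothGen lam (matOf o.1) (matOf o.2.1) (fun i k => o.2.2.1 k i) (fun i k => o.2.2.2 k i)

/-- The convergence theorem with a genuinely positive smoothness constant (so that the set of
admissible step sizes `0 < η ≤ 1/L` is nonempty). -/
theorem qpalign_convergence_pos
    (n d : ℕ) (ρ r lam : ℝ) (hr : 0 < r ∧ r < 1) (hlam : 0 < lam ∧ lam < 1) :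
    ∃ L : Obs n d → ℝ, (∀ o, 0 < L o) ∧
      ∀ δ : ℝ, 0 < δ → δ < 1 → 32 * Real.log ((n : ℝ) / Real.sqrt δ) < (d : ℝ) →
        1 - ENNReal.ofReal δ ≤
          obsLaw n d ρ r 1
            {o : Obs n d |
              ∀ η : ℝ, 0 < η → η ≤ (L o)⁻¹ →
              ∀ P : ℕ → Matrix (Fin n) (Fin n) ℝ,
                P 0 ∈ birkhoff n →
                (∀ k : ℕ, IsProjOn (P k - η • qpGrad lam o (P k)) (P (k + 1))) →
                ∀ Popt ∈ birkhoff n,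
                  (∀ Y ∈ birkhoff n, qpObj lam o Popt ≤ qpObj lam o Y) →
                  ∀ K : ℕ, 1 ≤ K →
                    Real.sqrt (frobSq (P K - Popt)) ≤
                      Real.sqrt ((n : ℝ) / ((1 - lam) * (1 - r) * d * η * K))} := by
  refine ⟨smoothL lam, fun o => smoothGen_pos hlam.1.le hlam.2.le _ _ _ _, ?_⟩
  intro δ hδ hδ1 hd
  refine (good_event n d ρ r hr δ hδ hd).trans (measure_mono fun o ho => ?_)
  intro η hη hηL P hP0 hP Z hZ hopt K hK
  rcases Nat.eq_zero_or_pos n with h0 | h0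
  · subst h0
    simp [frobSq]
  have hdpos : (0 : ℝ) < d := by
    refine lt_of_le_of_lt ?_ hd
    have hs1 : Real.sqrt δ ≤ 1 := by rw [Real.sqrt_le_one]; exact hδ1.le
    have hs : 0 < Real.sqrt δ := Real.sqrt_pos.2 hδ
    have hn : (1 : ℝ) ≤ n := by exact_mod_cast h0
    have : 0 ≤ Real.log ((n : ℝ) / Real.sqrt δ) :=
      Real.log_nonneg (by rw [le_div_iff₀ hs]; linarith)
    linarith
  have h := pgd_rate hlam.1.le hlam.2.le (matOf o.1) (matOf o.2.1) (fun i k => o.2.2.1 k i)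
    (fun i k => o.2.2.2 k i) ((1 - r) * d) ho η hη hηL P hP0 hP Z hZ hopt K
  have hl : 0 < 1 - lam := sub_pos.2 hlam.2
  have hr' : 0 < 1 - r := sub_pos.2 hr.2
  have hKpos : (0 : ℝ) < K := by exact_mod_cast hK
  apply Real.sqrt_le_sqrt
  rw [le_div_iff₀ (by positivity)]
  linarith

/-- Proposition: convergence guarantee of projected gradient
descent for QPAlign. Under the featured correlated Gaussian Wigner model with
`π* = id`: for any realization there is a constant `L = L(G1, G2)` such that for
any step size `0 < η ≤ 1/L` and any `0 < δ < 1`, if `d > 32 log(n/√δ)`, then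
with probability at least `1 - δ`, the projected gradient descent iterates
satisfy `‖Π^K − Π'‖_F ≤ √(n / ((1-λ)(1-r) d η K))` for every `K ≥ 1`, where
`Π' ∈ argmin_{W^n} f` and `Π^0 ∈ W^n`. -/
theorem qpalign_convergence
    (n d : ℕ) (ρ r lam : ℝ)
    (hρ : 0 < ρ ∧ ρ < 1) (hr : 0 < r ∧ r < 1) (hlam : 0 < lam ∧ lam < 1) :
    ∃ L : Obs n d → ℝ,
      ∀ δ : ℝ, 0 < δ → δ < 1 → 32 * Real.log ((n : ℝ) / Real.sqrt δ) < (d : ℝ) →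
        1 - ENNReal.ofReal δ ≤
          obsLaw n d ρ r 1
            {o : Obs n d |
              ∀ η : ℝ, 0 < η → η ≤ (L o)⁻¹ →
              ∀ P : ℕ → Matrix (Fin n) (Fin n) ℝ,
                P 0 ∈ birkhoff n →
                (∀ k : ℕ, IsProjOn (P k - η • qpGrad lam o (P k)) (P (k + 1))) →
                ∀ Popt ∈ birkhoff n,
                  (∀ Y ∈ birkhoff n, qpObj lam o Popt ≤ qpObj lam o Y) →
                  ∀ K : ℕ, 1 ≤ K →
                    Real.sqrt (frobSq (P K - Popt)) ≤
                      Real.sqrt ((n : ℝ) / ((1 - lam) * (1 - r) * d * η * K))} := by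
  obtain ⟨L, -, hL⟩ := qpalign_convergence_pos n d ρ r lam hr hlam
  exact ⟨L, hL⟩

end FCGW
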